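/- arXiv:cs/0703082 — 8 statements merged into one kernel-verified Lean document; each statement's English description precedes it below -/
import Mathlib

section
/- Discrete comparison principle (Lemma 3): Let S and T be grid functions on {0,…,n}² such that N_{ij}(S)·F_{ij} ≤ 1 and N_{ij}(T)·F_{ij} ≥ 1 for all (i,j) ∈ Ω_D. Then max over (i,j) ∈ Ω_D of (S_{ij} − T_{ij})⁺ is at most max over (i,j) ∈ Γ_D of (S_{ij} − T_{ij})⁺, where x⁺ = max(x, 0). -/
/-- Membership of an index pair in the grid `{0,…,n}²`. -/
def InGrid (n : ℕ) (p : ℤ × ℤ) : Prop :=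
  0 ≤ p.1 ∧ p.1 ≤ (n : ℤ) ∧ 0 ≤ p.2 ∧ p.2 ≤ (n : ℤ)

instance (n : ℕ) (p : ℤ × ℤ) : Decidable (InGrid n p) := by
  unfold InGrid; infer_instance

/-- The difference `T p − T q` when the neighbour `q` lies in the grid.  Out-of-range
neighbours carry the value `+∞`, so `T p − (+∞) = −∞` never realizes the maxima
`max(·, ·, 0)`; since `0` always occurs in those maxima, replacing `−∞` by `0`
gives exactly the same value. -/
noncomputable def gdiff (n : ℕ) (T : ℤ × ℤ → ℝ) (p q : ℤ × ℤ) : ℝ :=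
  if InGrid n q then T p - T q else 0

/-- The discrete approximation `N_{ij}(T)` of `‖∇T(ih, jh)‖` at the grid point `p = (i,j)`,
for grid spacing `h`:
`N_{ij}(T) = (1/h) · sqrt( max(T_{ij}−T_{i−1,j}, T_{ij}−T_{i+1,j}, 0)²
                         + max(T_{ij}−T_{i,j−1}, T_{ij}−T_{i,j+1}, 0)² )`. -/
noncomputable def Nop (n : ℕ) (h : ℝ) (T : ℤ × ℤ → ℝ) (p : ℤ × ℤ) : ℝ :=
  (1 / h) * Real.sqrt
    (max (max (gdiff n T p (p.1 - 1, p.2)) (gdiff n T p (p.1 + 1, p.2))) 0 ^ 2 +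
     max (max (gdiff n T p (p.1, p.2 - 1)) (gdiff n T p (p.1, p.2 + 1))) 0 ^ 2)

lemma aux_max (s1 s2 t1 t2 : ℝ) (h1 : t1 ≤ s1) (h2 : t2 ≤ s2)
    (k1 : 0 < t1 → t1 < s1) (k2 : 0 < t2 → t2 < s2) :
    0 ≤ max (max t1 t2) 0 ∧ max (max t1 t2) 0 ≤ max (max s1 s2) 0 ∧
    (0 < max (max t1 t2) 0 → max (max t1 t2) 0 < max (max s1 s2) 0) := by
  refine ⟨le_max_right _ _, max_le_max (max_le_max h1 h2) le_rfl, fun hp => ?_⟩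
  grind

/-- **Lemma 3 (discrete comparison principle).**
Let `S` and `T` be grid functions on `{0,…,n}²` such that `N_{ij}(S)·F_{ij} ≤ 1` and
`N_{ij}(T)·F_{ij} ≥ 1` for all `(i,j) ∈ Ω_D`.  Then
`max_{(i,j) ∈ Ω_D} (S_{ij} − T_{ij})⁺ ≤ max_{(i,j) ∈ Γ_D} (S_{ij} − T_{ij})⁺`. -/
theorem discrete_comparison_principle
    (n : ℕ) (hn : 1 ≤ n) (h : ℝ) (hh : h = 1 / (n : ℝ))
    (ΩD ΓD : Finset (ℤ × ℤ))
    (hpart : ΩD ∪ ΓD = Finset.Icc (0 : ℤ) (n : ℤ) ×ˢ Finset.Icc (0 : ℤ) (n : ℤ))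
    (hdisj : Disjoint ΩD ΓD) (hΓ : ΓD.Nonempty)
    (F S T : ℤ × ℤ → ℝ) (hF : ∀ p, 0 < F p)
    (hS : ∀ p ∈ ΩD, Nop n h S p * F p ≤ 1)
    (hT : ∀ p ∈ ΩD, 1 ≤ Nop n h T p * F p) :
    ∀ p ∈ ΩD, max (S p - T p) 0 ≤ ΓD.sup' hΓ fun q => max (S q - T q) 0 := by
  intro p0 hp0
  by_contra hcon
  rw [not_le, Finset.sup'_lt_iff] at hcon
  have hpos : 0 < S p0 - T p0 := by
    obtain ⟨q, hq⟩ := hΓ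
    have := hcon q hq
    grind
  have hlt : ∀ q ∈ ΓD, S q - T q < S p0 - T p0 := by
    intro q hq
    have := hcon q hq
    grind
  obtain ⟨m, hm, hmax⟩ := Finset.exists_max_image (ΩD ∪ ΓD) (fun q => S q - T q)
    ⟨p0, Finset.mem_union_left _ hp0⟩
  obtain ⟨p, hp, hmin⟩ := Finset.exists_min_image
    ((ΩD ∪ ΓD).filter (fun q => S q - T q = S m - T m)) T ⟨m, by simp [Finset.mem_filter, Finset.mem_union.1 hm]⟩
  rw [Finset.mem_filter] at hp
  have hpΩ : p ∈ ΩD := by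
    rcases Finset.mem_union.1 hp.1 with h1 | h1
    · exact h1
    · have := hlt p h1
      have := hmax p0 (Finset.mem_union_left _ hp0)
      linarith [hp.2]
  have key : ∀ q, gdiff n T p q ≤ gdiff n S p q ∧
      (0 < gdiff n T p q → gdiff n T p q < gdiff n S p q) := by
    intro q
    unfold gdiff
    split_ifs with hq
    · have hqm : q ∈ ΩD ∪ ΓD := by
        rw [hpart, Finset.mem_product, Finset.mem_Icc, Finset.mem_Icc]
        exact ⟨⟨hq.1, hq.2.1⟩, hq.2.2.1, hq.2.2.2⟩
      have h1 := hmax q hqm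
      refine ⟨by linarith [hp.2], fun hpos => ?_⟩
      by_contra hc
      have := hmin q (Finset.mem_filter.2 ⟨hqm, by linarith [hp.2]⟩)
      linarith
    · simp
  have hSp := hS p hpΩ
  have hTp := hT p hpΩ
  have hFp := hF p
  have hle : Nop n h S p ≤ Nop n h T p :=
    le_of_mul_le_mul_right (hSp.trans hTp) hFp
  have hTpos : 0 < Nop n h T p := by
    by_contra hc
    nlinarith
  have hh0 : 0 < 1 / h := by
    have : (0 : ℝ) < n := by exact_mod_cast hn
    rw [hh]; positivity
  unfold Nop at hle hTpos
  obtain ⟨a0, a1, a2⟩ := aux_max _ _ _ _ (key (p.1 - 1, p.2)).1 (key (p.1 + 1, p.2)).1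
    (key (p.1 - 1, p.2)).2 (key (p.1 + 1, p.2)).2
  obtain ⟨b0, b1, b2⟩ := aux_max _ _ _ _ (key (p.1, p.2 - 1)).1 (key (p.1, p.2 + 1)).1
    (key (p.1, p.2 - 1)).2 (key (p.1, p.2 + 1)).2
  have hle2 := le_of_mul_le_mul_left hle hh0
  have hpos2 := Real.sqrt_pos.1 (pos_of_mul_pos_right hTpos hh0.le)
  rw [Real.sqrt_le_sqrt_iff hpos2.le] at hle2
  generalize max (max (gdiff n T p (p.1 - 1, p.2)) (gdiff n T p (p.1 + 1, p.2))) 0 = a at *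
  generalize max (max (gdiff n T p (p.1, p.2 - 1)) (gdiff n T p (p.1, p.2 + 1))) 0 = b at *
  generalize max (max (gdiff n S p (p.1 - 1, p.2)) (gdiff n S p (p.1 + 1, p.2))) 0 = c at *
  generalize max (max (gdiff n S p (p.1, p.2 - 1)) (gdiff n S p (p.1, p.2 + 1))) 0 = d at *
  have hac : a ^ 2 ≤ c ^ 2 := pow_le_pow_left₀ a0 a1 2
  have hbd : b ^ 2 ≤ d ^ 2 := pow_le_pow_left₀ b0 b1 2
  rcases a0.lt_or_eq with ha | ha
  · have := pow_lt_pow_left₀ (a2 ha) a0 two_ne_zero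
    linarith
  · rcases b0.lt_or_eq with hb | hb
    · have := pow_lt_pow_left₀ (b2 hb) b0 two_ne_zero
      linarith
    · rw [← ha, ← hb] at hpos2
      norm_num at hpos2
end

section
/- Error estimate for the untidy-priority-queue fast marching solution (analytic core of Theorem 4): Let δ > 0 and let T be the exact discrete solution, i.e. N_{ij}(T)·F_{ij} = 1 for all (i,j) ∈ Ω_D and T_{ij} = 0 for (i,j) ∈ Γ_D. Let T̂ be a grid function with T̂_{ij} = 0 for (i,j) ∈ Γ_D and 1 ≤ N_{ij}(T̂)·F_{ij} ≤ 1 + √2·δ·F_max/h for all (i,j) ∈ Ω_D. Then for all (i,j) ∈ Ω_D: 0 ≤ T̂_{ij} − T_{ij} ≤ √2·(F_max/h)·δ·T̂_{ij}. In particular, with δ = h/(F_min·n_B) for an integer n_B ≥ 1, the relative error (T̂_{ij} − T_{ij})/T̂_{ij} is at most √2·(F_max/F_min)·(1/n_B) wherever T̂_{ij} > 0. -/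
/-- Monotonicity of the numerical Hamiltonian, with scaling. -/
theorem Nop_mono_scaled (n : ℕ) (h : ℝ) (hh : 0 < h) (U V : ℤ × ℤ → ℝ) (p : ℤ × ℤ) (l : ℝ)
    (hl : 0 ≤ l) (H : ∀ q, InGrid n q → V p - V q ≤ l * (U p - U q)) :
    Nop n h V p ≤ l * Nop n h U p := by
  have g : ∀ q, gdiff n V p q ≤ l * gdiff n U p q := by
    intro q
    unfold gdiff
    split_ifs with hq
    · exact H q hq
    · simp
  have m : ∀ q r, max (max (gdiff n V p q) (gdiff n V p r)) 0 ≤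
      l * max (max (gdiff n U p q) (gdiff n U p r)) 0 := by
    intro q r
    rw [mul_max_of_nonneg _ _ hl, mul_max_of_nonneg _ _ hl, mul_zero]
    exact max_le_max (max_le_max (g q) (g r)) le_rfl
  have m2 : ∀ q r, (max (max (gdiff n V p q) (gdiff n V p r)) 0) ^ 2 ≤
      l ^ 2 * (max (max (gdiff n U p q) (gdiff n U p r)) 0) ^ 2 := by
    intro q r
    rw [← mul_pow]
    exact pow_le_pow_left₀ (le_max_right _ _) (m q r) 2
  unfold Nop
  rw [mul_left_comm]
  refine mul_le_mul_of_nonneg_left ?_ (by positivity)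
  apply Real.sqrt_le_iff.mpr
  refine ⟨by positivity, ?_⟩
  rw [mul_pow, Real.sq_sqrt (by positivity), mul_add]
  exact add_le_add (m2 _ _) (m2 _ _)

/-- Comparison principle. -/
theorem fm_comparison (n : ℕ) (h : ℝ) (hh : 0 < h) (ΩD ΓD : Finset (ℤ × ℤ))
    (hpart : ΩD ∪ ΓD = Finset.Icc (0 : ℤ) (n : ℤ) ×ˢ Finset.Icc (0 : ℤ) (n : ℤ))
    (F : ℤ × ℤ → ℝ) (hF : ∀ p, 0 < F p) (U V : ℤ × ℤ → ℝ) (c : ℝ) (hc : 0 < c)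
    (hU : ∀ p ∈ ΩD, Nop n h U p * F p ≤ c) (hV : ∀ p ∈ ΩD, 1 ≤ Nop n h V p * F p)
    (hU0 : ∀ p ∈ ΓD, U p = 0) (hV0 : ∀ p ∈ ΓD, V p = 0) :
    ∀ p ∈ ΩD, U p ≤ c * V p := by
  have hmem : ∀ q, InGrid n q → q ∈ ΩD ∪ ΓD := by
    intro q hq
    rw [hpart]
    simpa [InGrid, Finset.mem_product, and_assoc] using hq
  have key : ∀ l : ℝ, 0 ≤ l → l * c < 1 → ∀ p ∈ ΩD, l * U p ≤ V p := by
    intro l hl hlc p hp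
    obtain ⟨m, hm, hmax⟩ := Finset.exists_max_image (ΩD ∪ ΓD) (fun q => l * U q - V q)
      ⟨p, Finset.mem_union_left _ hp⟩
    have hpm := hmax p (Finset.mem_union_left _ hp)
    rcases Finset.mem_union.mp hm with h1 | h1
    · exfalso
      have := Nop_mono_scaled n h hh U V m l hl (by
        intro q hq
        have := hmax q (hmem q hq)
        linarith)
      have a1 := mul_le_mul_of_nonneg_right this (hF m).le
      have a2 := mul_le_mul_of_nonneg_left (hU m h1) hl
      have a3 := hV m h1
      linarith
    · rw [hU0 m h1, hV0 m h1] at hpm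
      linarith
  intro p hp
  have hVp : 0 ≤ V p := by simpa using key 0 le_rfl (by simp) p hp
  by_contra! hlt
  have hUp : 0 < U p := lt_of_le_of_lt (by positivity) hlt
  have := key ((c * V p + U p) / (2 * c * U p)) (by positivity) (by
    have e : (c * V p + U p) / (2 * c * U p) * c = (c * V p + U p) / (2 * U p) := by
      field_simp
    rw [e, div_lt_one (by positivity)]
    linarith) p hp
  have e : (c * V p + U p) / (2 * c * U p) * U p = (c * V p + U p) / (2 * c) := by
    field_simp
  rw [e, div_le_iff₀ (by positivity)] at this
  linarith

/-- **Theorem 4 (error estimate for the untidy-priority-queue fast marching method,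
analytic core).**  Let `T` be the exact discrete solution, i.e. `N_{ij}(T)·F_{ij} = 1`
on `Ω_D` and `T = 0` on `Γ_D`, and let `T̂` vanish on `Γ_D` and satisfy
`1 ≤ N_{ij}(T̂)·F_{ij} ≤ 1 + √2·δ·F_max/h` on `Ω_D`.  Then for all `(i,j) ∈ Ω_D`,
`0 ≤ T̂_{ij} − T_{ij} ≤ √2·(F_max/h)·δ·T̂_{ij}`; in particular, for
`δ = h/(F_min·n_B)` with an integer `n_B ≥ 1`, the relative error
`(T̂_{ij} − T_{ij})/T̂_{ij}` is at most `√2·(F_max/F_min)·(1/n_B)` wherever `T̂_{ij} > 0`. -/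
theorem untidy_fast_marching_error_estimate
    (n : ℕ) (hn : 1 ≤ n) (h : ℝ) (hh : h = 1 / (n : ℝ))
    (ΩD ΓD : Finset (ℤ × ℤ))
    (hpart : ΩD ∪ ΓD = Finset.Icc (0 : ℤ) (n : ℤ) ×ˢ Finset.Icc (0 : ℤ) (n : ℤ))
    (hdisj : Disjoint ΩD ΓD) (hΓ : ΓD.Nonempty)
    (F : ℤ × ℤ → ℝ) (Fmin Fmax : ℝ) (hFmin : 0 < Fmin)
    (hF : ∀ p, Fmin ≤ F p ∧ F p ≤ Fmax)
    (δ : ℝ) (hδ : 0 < δ)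
    (T That : ℤ × ℤ → ℝ)
    (hTsol : ∀ p ∈ ΩD, Nop n h T p * F p = 1)
    (hTbd : ∀ p ∈ ΓD, T p = 0)
    (hThatbd : ∀ p ∈ ΓD, That p = 0)
    (hThat : ∀ p ∈ ΩD,
      1 ≤ Nop n h That p * F p ∧
      Nop n h That p * F p ≤ 1 + Real.sqrt 2 * δ * Fmax / h)
    (nB : ℕ) (hnB : 1 ≤ nB) :
    ∀ p ∈ ΩD,
      (0 ≤ That p - T p ∧
       That p - T p ≤ Real.sqrt 2 * (Fmax / h) * δ * That p) ∧
      (δ = h / (Fmin * nB) → 0 < That p →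
       (That p - T p) / That p ≤ Real.sqrt 2 * (Fmax / Fmin) * (1 / nB)) := by
  have hnpos : (0 : ℝ) < n := by exact_mod_cast hn
  have hpos : 0 < h := by rw [hh]; positivity
  have hFp : ∀ p, 0 < F p := fun p => lt_of_lt_of_le hFmin (hF p).1
  have hFmax : 0 < Fmax := lt_of_lt_of_le (hFp 0) (hF 0).2
  have hnBpos : (0 : ℝ) < nB := by exact_mod_cast hnB
  have heps : 0 < Real.sqrt 2 * δ * Fmax / h := by positivity
  intro p hp
  have h1 := fm_comparison n h hpos ΩD ΓD hpart F hFp T That 1 one_pos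
    (fun q hq => (hTsol q hq).le) (fun q hq => (hThat q hq).1) hTbd hThatbd p hp
  have h2 := fm_comparison n h hpos ΩD ΓD hpart F hFp That T (1 + Real.sqrt 2 * δ * Fmax / h)
    (by positivity) (fun q hq => (hThat q hq).2) (fun q hq => (hTsol q hq).ge) hThatbd hTbd p hp
  have e : Real.sqrt 2 * (Fmax / h) * δ = Real.sqrt 2 * δ * Fmax / h := by ring
  have h3 : That p - T p ≤ Real.sqrt 2 * (Fmax / h) * δ * That p := by
    rw [e]
    have := mul_le_mul_of_nonneg_left h1 heps.le
    linarith
  refine ⟨⟨by linarith, h3⟩, ?_⟩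
  intro hd hT
  rw [div_le_iff₀ hT]
  refine h3.trans (le_of_eq ?_)
  rw [hd]
  field_simp
end

section
/- Quantization keeps values between a supersolution and an inflated subsolution: Let a, b, c, d be real numbers, let w > 0 and δ > 0. Suppose X ∈ ℝ satisfies the local update equation max(X − a, X − b, 0)² + max(X − c, X − d, 0)² = w², and let Y ∈ ℝ satisfy X ≤ Y ≤ X + δ. Then w² ≤ max(Y − a, Y − b, 0)² + max(Y − c, Y − d, 0)² ≤ (w + √2·δ)². -/
theorem max_step_aux (a b δ X Y : ℝ) (hδ : 0 < δ) (hXY : X ≤ Y) (hYX : Y ≤ X + δ) :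
    0 ≤ max (max (X - a) (X - b)) 0 ∧
    max (max (X - a) (X - b)) 0 ≤ max (max (Y - a) (Y - b)) 0 ∧
    max (max (Y - a) (Y - b)) 0 ≤ max (max (X - a) (X - b)) 0 + δ := by
  have h1 : X - a ≤ max (max (X - a) (X - b)) 0 := by simp
  have h2 : X - b ≤ max (max (X - a) (X - b)) 0 := by simp
  have h3 : 0 ≤ max (max (X - a) (X - b)) 0 := by simp
  refine ⟨h3, by gcongr, ?_⟩
  refine max_le (max_le ?_ ?_) ?_ <;> linarith

/-- **Quantization keeps values between a supersolution and an inflated subsolution.**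
If `X` satisfies the local update equation
`max(X − a, X − b, 0)² + max(X − c, X − d, 0)² = w²` and `X ≤ Y ≤ X + δ`, then
`w² ≤ max(Y − a, Y − b, 0)² + max(Y − c, Y − d, 0)² ≤ (w + √2·δ)²`. -/
theorem quantization_between_sub_and_supersolution
    (a b c d w δ X Y : ℝ) (hw : 0 < w) (hδ : 0 < δ)
    (hX : max (max (X - a) (X - b)) 0 ^ 2 + max (max (X - c) (X - d)) 0 ^ 2 = w ^ 2)
    (hXY : X ≤ Y) (hYX : Y ≤ X + δ) :
    w ^ 2 ≤ max (max (Y - a) (Y - b)) 0 ^ 2 + max (max (Y - c) (Y - d)) 0 ^ 2 ∧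
    max (max (Y - a) (Y - b)) 0 ^ 2 + max (max (Y - c) (Y - d)) 0 ^ 2 ≤
      (w + Real.sqrt 2 * δ) ^ 2 := by
  obtain ⟨p0, p1, p2⟩ := max_step_aux a b δ X Y hδ hXY hYX
  obtain ⟨q0, q1, q2⟩ := max_step_aux c d δ X Y hδ hXY hYX
  generalize max (max (X - a) (X - b)) 0 = p at *
  generalize max (max (X - c) (X - d)) 0 = q at *
  generalize max (max (Y - a) (Y - b)) 0 = P at *
  generalize max (max (Y - c) (Y - d)) 0 = Q at *
  have hs : Real.sqrt 2 ^ 2 = 2 := Real.sq_sqrt (by norm_num)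
  have hs0 : 0 ≤ Real.sqrt 2 := Real.sqrt_nonneg 2
  constructor
  · rw [← hX]
    gcongr
  · have hP : P ^ 2 ≤ (p + δ) ^ 2 := by
      have : 0 ≤ P := p0.trans p1
      gcongr
    have hQ : Q ^ 2 ≤ (q + δ) ^ 2 := by
      have : 0 ≤ Q := q0.trans q1
      gcongr
    have hpq : p + q ≤ Real.sqrt 2 * w := by
      refine (abs_le_of_sq_le_sq' ?_ (by positivity)).2
      rw [mul_pow, hs, ← hX]
      nlinarith [sq_nonneg (p - q)]
    have := mul_le_mul_of_nonneg_right hpq hδ.le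
    have e : (w + Real.sqrt 2 * δ) ^ 2 = w ^ 2 + 2 * (Real.sqrt 2 * w * δ) + 2 * δ ^ 2 := by
      linear_combination δ ^ 2 * hs
    nlinarith
end

section
/- Variational formula for the local update (footnote 2, after [BR06]): Let a, b, c, d be real numbers and w > 0. Then X := min over s, t ≥ 0 with s + t = 1 of { s·min(a, b) + t·min(c, d) + w·sqrt(s² + t²) } satisfies the local update equation max(X − a, X − b, 0)² + max(X − c, X − d, 0)² = w². -/
theorem exists_update (p q w : ℝ) (hw : 0 < w) :
    ∃ Y : ℝ, max (Y - p) 0 ^ 2 + max (Y - q) 0 ^ 2 = w ^ 2 := by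
  have hc : Continuous (fun Y : ℝ => max (Y - p) 0 ^ 2 + max (Y - q) 0 ^ 2) := by fun_prop
  have h := intermediate_value_Icc (a := min p q) (b := p + w)
    (by linarith [min_le_left p q]) hc.continuousOn
  obtain ⟨Y, -, hY⟩ := h (show w ^ 2 ∈ _ by
    constructor
    · have h1 : max (min p q - p) 0 = 0 := max_eq_right (by linarith [min_le_left p q])
      have h2 : max (min p q - q) 0 = 0 := max_eq_right (by linarith [min_le_right p q])
      simp only [h1, h2]
      nlinarith
    · have h1 : max (p + w - p) 0 = w := by rw [max_eq_left] <;> linarith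
      simp only [h1]
      nlinarith [sq_nonneg (max (p + w - q) 0)])
  exact ⟨Y, hY⟩

theorem isLeast_update (p q w Y : ℝ) (hw : 0 < w)
    (hY : max (Y - p) 0 ^ 2 + max (Y - q) 0 ^ 2 = w ^ 2) :
    IsLeast {y : ℝ | ∃ s t : ℝ, 0 ≤ s ∧ 0 ≤ t ∧ s + t = 1 ∧
      y = s * p + t * q + w * Real.sqrt (s ^ 2 + t ^ 2)} Y := by
  have hu0 : 0 ≤ max (Y - p) 0 := le_max_right _ _
  have hv0 : 0 ≤ max (Y - q) 0 := le_max_right _ _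
  have hup : Y - p ≤ max (Y - p) 0 := le_max_left _ _
  have hvq : Y - q ≤ max (Y - q) 0 := le_max_left _ _
  have hu : max (Y - p) 0 * (max (Y - p) 0 - (Y - p)) = 0 := by
    rcases max_choice (Y - p) 0 with h | h <;> rw [h] <;> ring
  have hv : max (Y - q) 0 * (max (Y - q) 0 - (Y - q)) = 0 := by
    rcases max_choice (Y - q) 0 with h | h <;> rw [h] <;> ring
  generalize max (Y - p) 0 = u at *
  generalize max (Y - q) 0 = v at *
  have hpos : 0 < u + v := by
    by_contra h
    have h1 : u = 0 := by linarith
    have h2 : v = 0 := by linarith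
    subst h1 h2
    nlinarith
  constructor
  · refine ⟨u / (u + v), v / (u + v), by positivity, by positivity, by field_simp, ?_⟩
    have hs : Real.sqrt ((u / (u + v)) ^ 2 + (v / (u + v)) ^ 2) = w / (u + v) := by
      rw [show (u / (u + v)) ^ 2 + (v / (u + v)) ^ 2 = (w / (u + v)) ^ 2 by
        rw [div_pow, div_pow, div_pow, ← hY]; ring]
      exact Real.sqrt_sq (by positivity)
    rw [hs]
    field_simp
    linarith
  · rintro y ⟨s, t, hs, ht, hst, rfl⟩
    have hle : s * u + t * v ≤ w * Real.sqrt (s ^ 2 + t ^ 2) := by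
      refine (sq_le_sq₀ (by positivity) (by positivity)).1 ?_
      rw [mul_pow, Real.sq_sqrt (by positivity), ← hY]
      nlinarith [sq_nonneg (s * v - t * u)]
    have h1 := mul_le_mul_of_nonneg_left hup hs
    have h2 := mul_le_mul_of_nonneg_left hvq ht
    have h3 : (s + t) * Y = Y := by rw [hst, one_mul]
    linarith


/-- **Variational formula for the local update** (footnote 2, after [BR06]):
`X := min_{s + t = 1, s, t ≥ 0} { s·min(a,b) + t·min(c,d) + w·sqrt(s² + t²) }`
satisfies the local update equation
`max(X − a, X − b, 0)² + max(X − c, X − d, 0)² = w²`. -/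
theorem variational_formula_local_update
    (a b c d w : ℝ) (hw : 0 < w) (X : ℝ)
    (hX : X = sInf {y : ℝ | ∃ s t : ℝ, 0 ≤ s ∧ 0 ≤ t ∧ s + t = 1 ∧
      y = s * min a b + t * min c d + w * Real.sqrt (s ^ 2 + t ^ 2)}) :
    max (max (X - a) (X - b)) 0 ^ 2 + max (max (X - c) (X - d)) 0 ^ 2 = w ^ 2 := by

  obtain ⟨Y, hY⟩ := exists_update (min a b) (min c d) w hw
  rw [(isLeast_update _ _ w Y hw hY).csInf_eq] at hX
  subst hX
  rw [max_sub_sub_left, max_sub_sub_left]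
  exact hY
end

section
/- Existence and uniqueness of the local update value: For all real numbers a, b, c, d and every w > 0, there exists exactly one real number X satisfying the local update equation max(X − a, X − b, 0)² + max(X − c, X − d, 0)² = w². -/
lemma aux_mono (p x y : ℝ) (h : x < y) : max (x - p) 0 ^ 2 ≤ max (y - p) 0 ^ 2 := by
  have : max (x - p) 0 ≤ max (y - p) 0 := max_le_max (by linarith) le_rfl
  exact pow_le_pow_left₀ (le_max_right _ _) this 2

lemma aux_strict (p x y : ℝ) (h : x < y) (hp : p < x) :
    max (x - p) 0 ^ 2 < max (y - p) 0 ^ 2 := by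
  rw [max_eq_left (by linarith), max_eq_left (by linarith)]
  exact pow_lt_pow_left₀ (by linarith) (by linarith) (by norm_num)

lemma aux_lt (p q w x y : ℝ) (hw : 0 < w) (h : x < y)
    (hx : max (x - p) 0 ^ 2 + max (x - q) 0 ^ 2 = w ^ 2) :
    w ^ 2 < max (y - p) 0 ^ 2 + max (y - q) 0 ^ 2 := by
  rw [← hx]
  by_cases hp : p < x
  · exact add_lt_add_of_lt_of_le (aux_strict p x y h hp) (aux_mono q x y h)
  by_cases hq : q < x
  · exact add_lt_add_of_le_of_lt (aux_mono p x y h) (aux_strict q x y h hq)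
  rw [max_eq_right (by linarith), max_eq_right (by linarith)] at hx
  have := pow_pos hw 2
  linarith

/-- **Existence and uniqueness of the local update value**: for all reals `a, b, c, d`
and every `w > 0`, there exists exactly one `X` with
`max(X − a, X − b, 0)² + max(X − c, X − d, 0)² = w²`. -/
theorem local_update_existsUnique
    (a b c d w : ℝ) (hw : 0 < w) :
    ∃! X : ℝ,
      max (max (X - a) (X - b)) 0 ^ 2 + max (max (X - c) (X - d)) 0 ^ 2 = w ^ 2 := by
  simp only [max_sub_sub_left]
  generalize min a b = p
  generalize min c d = q
  have hc : Continuous fun X : ℝ => max (X - p) 0 ^ 2 + max (X - q) 0 ^ 2 := by fun_prop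
  have hm : min p q ≤ p + w := (min_le_left p q).trans (by linarith)
  obtain ⟨X, -, hX⟩ := intermediate_value_Icc hm hc.continuousOn (show w ^ 2 ∈ _ by
    constructor
    · have h1 := min_le_left p q
      have h2 := min_le_right p q
      rw [max_eq_right (by linarith), max_eq_right (by linarith)]
      have := pow_pos hw 2
      linarith
    · skip
      rw [add_sub_cancel_left, max_eq_left hw.le]
      have := sq_nonneg (max (p + w - q) 0)
      linarith)
  refine ⟨X, hX, fun Y hY => ?_⟩
  simp only at hX hY
  rcases lt_trichotomy Y X with h | h | h
  · have := aux_lt p q w Y X hw h hY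
    linarith
  · exact h
  · have := aux_lt p q w X Y hw h hX
    linarith
end

section
/- Two-sided bound on the local update value (upwind causality and the step bound used in the proof of Lemma 1): Let a, b, c, d be real numbers and w > 0, and let X ∈ ℝ satisfy the local update equation max(X − a, X − b, 0)² + max(X − c, X − d, 0)² = w². Then min(a, b, c, d) < X ≤ min(a, b, c, d) + w. -/
/-- **Two-sided bound on the local update value** (upwind causality and the step bound
used in the proof of Lemma 1): if `X` satisfies the local update equation
`max(X − a, X − b, 0)² + max(X − c, X − d, 0)² = w²`, then
`min(a, b, c, d) < X ≤ min(a, b, c, d) + w`. -/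
theorem local_update_two_sided_bound
    (a b c d w X : ℝ) (hw : 0 < w)
    (hX : max (max (X - a) (X - b)) 0 ^ 2 + max (max (X - c) (X - d)) 0 ^ 2 = w ^ 2) :
    min (min a b) (min c d) < X ∧ X ≤ min (min a b) (min c d) + w := by
  constructor
  · by_contra! h
    simp only [le_min_iff] at h
    obtain ⟨⟨h1, h2⟩, h3, h4⟩ := h
    have e1 : max (max (X - a) (X - b)) 0 = 0 :=
      max_eq_right (max_le (by linarith) (by linarith))
    have e2 : max (max (X - c) (X - d)) 0 = 0 :=
      max_eq_right (max_le (by linarith) (by linarith))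
    rw [e1, e2] at hX
    nlinarith [pow_pos hw 2]
  · have p : max (max (X - a) (X - b)) 0 ≤ w :=
      (abs_le_of_sq_le_sq' (by nlinarith [sq_nonneg (max (max (X - c) (X - d)) 0)]) hw.le).2
    have q : max (max (X - c) (X - d)) 0 ≤ w :=
      (abs_le_of_sq_le_sq' (by nlinarith [sq_nonneg (max (max (X - a) (X - b)) 0)]) hw.le).2
    simp only [max_le_iff] at p q
    obtain ⟨⟨h1, h2⟩, -⟩ := p
    obtain ⟨⟨h3, h4⟩, -⟩ := q
    rw [← sub_le_iff_le_add]
    exact le_min (le_min (by linarith) (by linarith)) (le_min (by linarith) (by linarith))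
end

section
/- A priori bound on the discrete solution (claim used in the proof of Lemma 2): Let T be a grid function with N_{ij}(T)·F_{ij} = 1 for all (i,j) ∈ Ω_D and T_{ij} = 0 for all (i,j) ∈ Γ_D. Then T_{ij} ≤ 2/F_min for all (i,j) ∈ {0,…,n}². -/
lemma Nop_step (n : ℕ) (h : ℝ) (hpos : 0 < h) (T : ℤ × ℤ → ℝ) (p q : ℤ × ℤ) (f m : ℝ)
    (hm : 0 < m) (hmf : m ≤ f) (hN : Nop n h T p * f = 1) (hq : InGrid n q)
    (hpq : q = (p.1 - 1, p.2) ∨ q = (p.1 + 1, p.2) ∨ q = (p.1, p.2 - 1) ∨ q = (p.1, p.2 + 1)) :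
    T p ≤ T q + h / m := by
  have hg : gdiff n T p q = T p - T q := by simp [gdiff, hq]
  unfold Nop at hN
  set A := max (max (gdiff n T p (p.1 - 1, p.2)) (gdiff n T p (p.1 + 1, p.2))) 0 with hA
  set B := max (max (gdiff n T p (p.1, p.2 - 1)) (gdiff n T p (p.1, p.2 + 1))) 0 with hB
  have hf : 0 < f := lt_of_lt_of_le hm hmf
  have hS : Real.sqrt (A ^ 2 + B ^ 2) = h / f := by
    field_simp at hN ⊢
    linarith
  have hle : h / f ≤ h / m := by gcongr
  have hAS : A ≤ Real.sqrt (A ^ 2 + B ^ 2) := Real.le_sqrt_of_sq_le (by nlinarith [sq_nonneg B])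
  have hBS : B ≤ Real.sqrt (A ^ 2 + B ^ 2) := Real.le_sqrt_of_sq_le (by nlinarith [sq_nonneg A])
  have key : gdiff n T p q ≤ A ∨ gdiff n T p q ≤ B := by
    rcases hpq with e | e | e | e
    · left; rw [e, hA]; simp
    · left; rw [e, hA]; simp
    · right; rw [e, hB]; simp
    · right; rw [e, hB]; simp
  rcases key with k | k <;> linarith

/-- **A priori bound on the discrete solution** (claim used in the proof of Lemma 2):
if `N_{ij}(T)·F_{ij} = 1` for all `(i,j) ∈ Ω_D` and `T_{ij} = 0` for all `(i,j) ∈ Γ_D`,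
then `T_{ij} ≤ 2/F_min` for all `(i,j) ∈ {0,…,n}²`. -/
theorem discrete_solution_apriori_bound
    (n : ℕ) (hn : 1 ≤ n) (h : ℝ) (hh : h = 1 / (n : ℝ))
    (ΩD ΓD : Finset (ℤ × ℤ))
    (hpart : ΩD ∪ ΓD = Finset.Icc (0 : ℤ) (n : ℤ) ×ˢ Finset.Icc (0 : ℤ) (n : ℤ))
    (hdisj : Disjoint ΩD ΓD) (hΓ : ΓD.Nonempty)
    (F : ℤ × ℤ → ℝ) (Fmin Fmax : ℝ) (hFmin : 0 < Fmin)
    (hF : ∀ p, Fmin ≤ F p ∧ F p ≤ Fmax)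
    (T : ℤ × ℤ → ℝ)
    (hTsol : ∀ p ∈ ΩD, Nop n h T p * F p = 1)
    (hTbd : ∀ p ∈ ΓD, T p = 0) :
    ∀ p : ℤ × ℤ, InGrid n p → T p ≤ 2 / Fmin := by
  have hn0 : (0 : ℝ) < n := by exact_mod_cast hn
  have hpos : 0 < h := by rw [hh]; positivity
  have hc : 0 < h / Fmin := by positivity
  obtain ⟨g, hg⟩ := hΓ
  have hgG : InGrid n g := by
    have : g ∈ ΩD ∪ ΓD := Finset.mem_union_right _ hg
    rw [hpart] at this
    simp only [Finset.mem_product, Finset.mem_Icc] at this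
    unfold InGrid
    tauto
  have main : ∀ k : ℕ, ∀ p : ℤ × ℤ, InGrid n p → |p.1 - g.1| + |p.2 - g.2| ≤ (k : ℤ) →
      T p ≤ k * (h / Fmin) := by
    intro k
    induction k with
    | zero =>
      intro p hp hd
      have h1 : p = g := by
        ext <;> grind
      rw [h1, hTbd g hg]; simp
    | succ k ih =>
      intro p hp hd
      by_cases hpΓ : p ∈ ΓD
      · rw [hTbd p hpΓ]; positivity
      have hpΩ : p ∈ ΩD := by
        have : p ∈ ΩD ∪ ΓD := by
          rw [hpart]
          simp only [Finset.mem_product, Finset.mem_Icc]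
          unfold InGrid at hp
          tauto
        exact (Finset.mem_union.mp this).resolve_right hpΓ
      have hne : p.1 ≠ g.1 ∨ p.2 ≠ g.2 := by
        by_contra hcon
        push Not at hcon
        exact hpΓ ((Prod.ext hcon.1 hcon.2 : p = g) ▸ hg)
      have hex : ∃ q : ℤ × ℤ, InGrid n q ∧ |q.1 - g.1| + |q.2 - g.2| ≤ (k : ℤ) ∧
          (q = (p.1 - 1, p.2) ∨ q = (p.1 + 1, p.2) ∨ q = (p.1, p.2 - 1) ∨
            q = (p.1, p.2 + 1)) := by
        unfold InGrid at *
        push_cast at hd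
        rcases hne with e | e <;> rcases lt_or_gt_of_ne e with l | l
        · exact ⟨(p.1 + 1, p.2), by dsimp only; omega, by
            dsimp only
            rcases abs_cases (p.1 + 1 - g.1) with c | c <;>
            rcases abs_cases (p.1 - g.1) with a | a <;> rcases abs_cases (p.2 - g.2) with b | b <;>
              omega, by simp⟩
        · exact ⟨(p.1 - 1, p.2), by dsimp only; omega, by
            dsimp only
            rcases abs_cases (p.1 - 1 - g.1) with c | c <;>
            rcases abs_cases (p.1 - g.1) with a | a <;> rcases abs_cases (p.2 - g.2) with b | b <;>
              omega, by simp⟩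
        · exact ⟨(p.1, p.2 + 1), by dsimp only; omega, by
            dsimp only
            rcases abs_cases (p.2 + 1 - g.2) with c | c <;>
            rcases abs_cases (p.1 - g.1) with a | a <;> rcases abs_cases (p.2 - g.2) with b | b <;>
              omega, by simp⟩
        · exact ⟨(p.1, p.2 - 1), by dsimp only; omega, by
            dsimp only
            rcases abs_cases (p.2 - 1 - g.2) with c | c <;>
            rcases abs_cases (p.1 - g.1) with a | a <;> rcases abs_cases (p.2 - g.2) with b | b <;>
              omega, by simp⟩
      obtain ⟨q, hq, hqd, hqp⟩ := hex
      have h1 := Nop_step n h hpos T p q (F p) Fmin hFmin (hF p).1 (hTsol p hpΩ) hq hqp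
      have h2 := ih q hq hqd
      push_cast
      linarith
  intro p hp
  have h1 := main (2 * n) p hp (by unfold InGrid at *; push_cast; grind)
  have h2 : ((2 * n : ℕ) : ℝ) * (h / Fmin) = 2 / Fmin := by
    rw [hh]; push_cast; field_simp
  linarith
end

section
/- Nonnegativity of discrete supersolutions with zero boundary data (consequence of Lemma 3): Let T be a grid function with N_{ij}(T)·F_{ij} ≥ 1 for all (i,j) ∈ Ω_D and T_{ij} = 0 for all (i,j) ∈ Γ_D. Then T_{ij} ≥ 0 for all (i,j) ∈ {0,…,n}². -/
/-- **Nonnegativity of discrete supersolutions with zero boundary data**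
(consequence of Lemma 3): if `N_{ij}(T)·F_{ij} ≥ 1` for all `(i,j) ∈ Ω_D` and
`T_{ij} = 0` for all `(i,j) ∈ Γ_D`, then `T_{ij} ≥ 0` for all `(i,j) ∈ {0,…,n}²`. -/
theorem discrete_supersolution_nonneg
    (n : ℕ) (hn : 1 ≤ n) (h : ℝ) (hh : h = 1 / (n : ℝ))
    (ΩD ΓD : Finset (ℤ × ℤ))
    (hpart : ΩD ∪ ΓD = Finset.Icc (0 : ℤ) (n : ℤ) ×ˢ Finset.Icc (0 : ℤ) (n : ℤ))
    (hdisj : Disjoint ΩD ΓD) (hΓ : ΓD.Nonempty)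
    (F : ℤ × ℤ → ℝ) (hF : ∀ p, 0 < F p)
    (T : ℤ × ℤ → ℝ)
    (hTsup : ∀ p ∈ ΩD, 1 ≤ Nop n h T p * F p)
    (hTbd : ∀ p ∈ ΓD, T p = 0) :
    ∀ p : ℤ × ℤ, InGrid n p → 0 ≤ T p := by
  intro p hp
  have mem : ∀ q : ℤ × ℤ, q ∈ ΩD ∪ ΓD ↔ InGrid n q := by
    intro q
    rw [hpart, Finset.mem_product, Finset.mem_Icc, Finset.mem_Icc]
    unfold InGrid
    tauto
  obtain ⟨m, hm, hmin⟩ := Finset.exists_min_image (ΩD ∪ ΓD) T ⟨p, (mem p).2 hp⟩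
  have hle : T m ≤ T p := hmin p ((mem p).2 hp)
  have hg : ∀ q, gdiff n T m q ≤ 0 := by
    intro q
    unfold gdiff
    split_ifs with hq
    · exact sub_nonpos.2 (hmin q ((mem q).2 hq))
    · exact le_refl _
  rcases Finset.mem_union.1 hm with hΩ | hΓm
  · exfalso
    have h1 := hTsup m hΩ
    have h0 : Nop n h T m = 0 := by
      unfold Nop
      rw [max_eq_right (max_le (hg _) (hg _)), max_eq_right (max_le (hg _) (hg _))]
      simp
    rw [h0] at h1
    linarith
  · rw [← hTbd m hΓm]
    exact hle
end
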